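/- arXiv:1404.1321 — 8 statements merged into one kernel-verified Lean document; each statement's English description precedes it below -/
import Mathlib

section
/- Fix n ≥ 1 and let P = EuclideanSpace ℝ (Fin n) × EuclideanSpace ℝ (Fin n) be the flat phase space (tangent bundle of Euclidean space), with canonical symplectic form ω₂((v₁,p₁),(v₂,p₂)) = ⟪p₁,v₂⟫ − ⟪p₂,v₁⟫ and kinetic energy T(x,v) = ½‖v‖². Let w : P → EuclideanSpace ℝ (Fin n) be any map and let D be the associated second-order field D(x,v) = (v, w(x,v)). Then for every (x,v) ∈ P and every tangent vector (v',p') ∈ EuclideanSpace ℝ (Fin n) × EuclideanSpace ℝ (Fin n) one has ω₂(D(x,v),(v',p')) + fderiv ℝ T (x,v) (v',p') = ⟪w(x,v), v'⟫. Consequently, given a horizontal 1-form α determined by a map a : P → EuclideanSpace ℝ (Fin n) via α(x,v)(v',p') = ⟪a(x,v), v'⟫, the Newton equation i_D ω₂ + dT + α = 0 holds at every point if and only if w = −a; in particular a ↦ D is a bijection between horizontal 1-forms and second-order differential equations. -/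
open InnerProductSpace

/-- Flat phase space: tangent bundle of Euclidean space. -/
abbrev Phase (n : ℕ) := EuclideanSpace ℝ (Fin n) × EuclideanSpace ℝ (Fin n)

/-- Canonical symplectic form on flat phase space:
`ω₂((v₁,p₁),(v₂,p₂)) = ⟪p₁,v₂⟫ − ⟪p₂,v₁⟫`. -/
noncomputable def omega2 {n : ℕ} (u v : Phase n) : ℝ :=
  ⟪u.2, v.1⟫_ℝ - ⟪v.2, u.1⟫_ℝ

/-- Kinetic energy `T(x,v) = ½‖v‖²`. -/
noncomputable def kinEnergy {n : ℕ} (xv : Phase n) : ℝ := (1 / 2) * ‖xv.2‖ ^ 2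

/-- Second-order field associated to the force `w`: `D(x,v) = (v, w(x,v))`. -/
def secondOrderField {n : ℕ} (w : Phase n → EuclideanSpace ℝ (Fin n)) (xv : Phase n) :
    Phase n := (xv.2, w xv)

theorem newton_aux_fderiv {n : ℕ} (xv : Phase n) (v' p' : EuclideanSpace ℝ (Fin n)) :
    fderiv ℝ kinEnergy xv (v', p') = ⟪p', xv.2⟫_ℝ := by
  have h : HasFDerivAt (fun y : Phase n => (1 / 2 : ℝ) * ‖y.2‖ ^ 2) _ xv :=
    ((hasFDerivAt_snd (𝕜 := ℝ) (p := xv)).norm_sq).const_mul (1 / 2 : ℝ)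
  have h2 : HasFDerivAt (kinEnergy (n := n)) _ xv := h
  rw [h2.fderiv]
  simp [real_inner_comm]

theorem newton_aux_main {n : ℕ} (D : Phase n → Phase n) (xv : Phase n)
    (hD : (D xv).1 = xv.2) (v' p' : EuclideanSpace ℝ (Fin n)) :
    omega2 (D xv) (v', p') + fderiv ℝ kinEnergy xv (v', p') = ⟪(D xv).2, v'⟫_ℝ := by
  rw [newton_aux_fderiv, omega2, hD]
  ring

theorem newton_aux_iff {n : ℕ} (D : Phase n → Phase n) (hD : ∀ xv, (D xv).1 = xv.2)
    (a : Phase n → EuclideanSpace ℝ (Fin n)) :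
    (∀ xv : Phase n, ∀ v' p' : EuclideanSpace ℝ (Fin n),
      omega2 (D xv) (v', p') + fderiv ℝ kinEnergy xv (v', p') + ⟪a xv, v'⟫_ℝ = 0)
      ↔ ∀ xv, (D xv).2 = -a xv := by
  constructor
  · intro h xv
    have h1 := h xv ((D xv).2 + a xv) 0
    rw [newton_aux_main D xv (hD xv), ← inner_add_left, inner_self_eq_zero] at h1
    exact eq_neg_of_add_eq_zero_left h1
  · intro h xv v' p'
    rw [newton_aux_main D xv (hD xv), h xv, inner_neg_left]
    ring

theorem newton_equation_correspondence (n : ℕ) (hn : 1 ≤ n)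
    (w : Phase n → EuclideanSpace ℝ (Fin n)) :
    -- the fundamental computation
    (∀ xv : Phase n, ∀ v' p' : EuclideanSpace ℝ (Fin n),
        omega2 (secondOrderField w xv) (v', p') + fderiv ℝ kinEnergy xv (v', p')
          = ⟪w xv, v'⟫_ℝ) ∧
    -- Newton's equation `i_D ω₂ + dT + α = 0` holds iff `w = −a`
    (∀ a : Phase n → EuclideanSpace ℝ (Fin n),
        (∀ xv : Phase n, ∀ v' p' : EuclideanSpace ℝ (Fin n),
            omega2 (secondOrderField w xv) (v', p') + fderiv ℝ kinEnergy xv (v', p')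
              + ⟪a xv, v'⟫_ℝ = 0)
          ↔ w = fun xv => -a xv) ∧
    -- each second order differential equation corresponds to a unique horizontal 1-form
    (∀ D : Phase n → Phase n, (∀ xv, (D xv).1 = xv.2) →
        ∃! a : Phase n → EuclideanSpace ℝ (Fin n),
          ∀ xv : Phase n, ∀ v' p' : EuclideanSpace ℝ (Fin n),
            omega2 (D xv) (v', p') + fderiv ℝ kinEnergy xv (v', p')
              + ⟪a xv, v'⟫_ℝ = 0) := by
  refine ⟨fun xv v' p' => newton_aux_main (secondOrderField w) xv rfl v' p', fun a => ?_,
    fun D hD => ⟨fun xv => -(D xv).2, ?_, ?_⟩⟩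
  · rw [newton_aux_iff (secondOrderField w) (fun _ => rfl) a, funext_iff]
    rfl
  · exact (newton_aux_iff D hD _).2 fun xv => (neg_neg _).symm
  · intro b hb
    funext xv
    rw [(newton_aux_iff D hD b).1 hb xv, neg_neg]
end

section
/- Fix n ≥ 1. Let w : EuclideanSpace ℝ (Fin n) × EuclideanSpace ℝ (Fin n) → EuclideanSpace ℝ (Fin n) be continuous and let u : EuclideanSpace ℝ (Fin n) → EuclideanSpace ℝ (Fin n) be continuously differentiable. Then the following are equivalent: (i) for every x, (fderiv ℝ u x)(u x) = w(x, u x); (ii) for every differentiable curve γ : I → EuclideanSpace ℝ (Fin n) on an open interval I satisfying γ'(t) = u(γ(t)) for all t ∈ I, the curve γ is twice differentiable on I and γ''(t) = w(γ(t), γ'(t)) for all t ∈ I. (The implication (ii) ⇒ (i) uses the existence, for each point x₀, of a local integral curve of u through x₀, which holds since u is C¹.) -/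
open InnerProductSpace

/-- Characterization of intermediate integrals of a second-order differential
equation `x'' = w(x, x')` in flat Euclidean coordinates: a `C¹` vector field `u`
satisfies the first-order PDE `(fderiv u)(u) = w(·, u)` if and only if every
integral curve of `u` on an open interval solves the second-order equation. -/
theorem intermediate_integral_characterization (n : ℕ) (hn : 1 ≤ n)
    (w : EuclideanSpace ℝ (Fin n) × EuclideanSpace ℝ (Fin n) → EuclideanSpace ℝ (Fin n))
    (hw : Continuous w)
    (u : EuclideanSpace ℝ (Fin n) → EuclideanSpace ℝ (Fin n))
    (hu : ContDiff ℝ 1 u) :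
    (∀ x : EuclideanSpace ℝ (Fin n), fderiv ℝ u x (u x) = w (x, u x)) ↔
    (∀ (a b : ℝ) (γ : ℝ → EuclideanSpace ℝ (Fin n)),
      (∀ t ∈ Set.Ioo a b, HasDerivAt γ (u (γ t)) t) →
      ∀ t ∈ Set.Ioo a b,
        HasDerivAt (fun s => u (γ s)) (w (γ t, u (γ t))) t) := by
  have key : ∀ (γ : ℝ → EuclideanSpace ℝ (Fin n)) (t : ℝ), HasDerivAt γ (u (γ t)) t →
      HasDerivAt (fun s => u (γ s)) (fderiv ℝ u (γ t) (u (γ t))) t := by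
    intro γ t h
    have hd : HasFDerivAt u (fderiv ℝ u (γ t)) (γ t) :=
      ((hu.differentiable (by norm_num)) (γ t)).hasFDerivAt
    exact hd.comp_hasDerivAt t h
  constructor
  · intro h a b γ hγ t ht
    rw [← h (γ t)]
    exact key γ t (hγ t ht)
  · intro h x
    obtain ⟨γ, h0, ε, hε, hγ⟩ :=
      (hu.contDiffAt (x := x)).exists_forall_mem_closedBall_exists_eq_forall_mem_Ioo_hasDerivAt₀ 0
    have ht : (0 : ℝ) ∈ Set.Ioo (0 - ε) (0 + ε) := by constructor <;> linarith
    have := (key γ 0 (hγ 0 ht)).unique (h _ _ γ hγ 0 ht)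
    rwa [h0] at this
end

section
/- Fix n ≥ 1. Let w : EuclideanSpace ℝ (Fin n) × EuclideanSpace ℝ (Fin n) → EuclideanSpace ℝ (Fin n) be continuously differentiable, and suppose that every twice differentiable curve γ : I → EuclideanSpace ℝ (Fin n) on an open interval I satisfying γ''(t) = w(γ(t), γ'(t)) for all t ∈ I has t ↦ ‖γ'(t)‖² constant on I. Then ⟪w(x,v), v⟫ = 0 for all (x,v). (The proof uses local existence of a solution of the second-order equation with arbitrary prescribed initial position x and initial velocity v, available by Picard–Lindelöf since w is C¹.) -/
open InnerProductSpace

/-- Converse direction: if every twice differentiable solution of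
`x'' = w(x, x')` on an open interval has constant `‖x'‖²`, and `w` is `C¹`,
then `⟪w(x,v), v⟫ = 0` for all `(x,v)`. -/
theorem constant_speed_implies_relativistic_force (n : ℕ) (hn : 1 ≤ n)
    (w : EuclideanSpace ℝ (Fin n) × EuclideanSpace ℝ (Fin n) → EuclideanSpace ℝ (Fin n))
    (hw : ContDiff ℝ 1 w)
    (hconst : ∀ (a b : ℝ) (γ γ' : ℝ → EuclideanSpace ℝ (Fin n)),
      (∀ t ∈ Set.Ioo a b, HasDerivAt γ (γ' t) t) →
      (∀ t ∈ Set.Ioo a b, HasDerivAt γ' (w (γ t, γ' t)) t) →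
      ∀ t₁ ∈ Set.Ioo a b, ∀ t₂ ∈ Set.Ioo a b, ‖γ' t₁‖ ^ 2 = ‖γ' t₂‖ ^ 2) :
    ∀ (x v : EuclideanSpace ℝ (Fin n)), ⟪w (x, v), v⟫_ℝ = 0 := by
  intro x v
  have hf : ContDiff ℝ 1 (fun p : EuclideanSpace ℝ (Fin n) × EuclideanSpace ℝ (Fin n) =>
      (p.2, w p)) := contDiff_snd.prodMk hw
  obtain ⟨α, h0, ε, hε, hα⟩ :=
    ContDiffAt.exists_forall_mem_closedBall_exists_eq_forall_mem_Ioo_hasDerivAt₀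
      (hf.contDiffAt (x := (x, v))) 0
  have h1 : ∀ t ∈ Set.Ioo (0 - ε) (0 + ε), HasDerivAt (fun s => (α s).1) ((α t).2) t :=
    fun t ht => (hasFDerivAt_fst (𝕜 := ℝ) (p := α t)).comp_hasDerivAt t (hα t ht)
  have h2 : ∀ t ∈ Set.Ioo (0 - ε) (0 + ε),
      HasDerivAt (fun s => (α s).2) (w ((α t).1, (α t).2)) t :=
    fun t ht => (hasFDerivAt_snd (𝕜 := ℝ) (p := α t)).comp_hasDerivAt t (hα t ht)
  have hc := hconst _ _ _ _ h1 h2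
  have hm : (0 : ℝ) ∈ Set.Ioo (0 - ε) (0 + ε) := ⟨by linarith, by linarith⟩
  have hd := (h2 0 hm).norm_sq
  have hz : HasDerivAt (fun s => ‖(α s).2‖ ^ 2) 0 0 := by
    refine (hasDerivAt_const (0 : ℝ) (‖(α 0).2‖ ^ 2)).congr_of_eventuallyEq ?_
    filter_upwards [Ioo_mem_nhds hm.1 hm.2] with t ht
    exact hc t ht 0 hm
  have he := hd.unique hz
  simp only [h0] at he
  rw [real_inner_comm]
  linarith
end

section
/- Fix n ≥ 1. Let a : EuclideanSpace ℝ (Fin n) × EuclideanSpace ℝ (Fin n) → EuclideanSpace ℝ (Fin n) satisfy ⟪a(x,v), v⟫ = 0 for all (x,v) (i.e., the horizontal 1-form α(x,v) = ⟪a(x,v), ·⟫ belongs to the contact system). Suppose there exists a differentiable function F : EuclideanSpace ℝ (Fin n) × EuclideanSpace ℝ (Fin n) → ℝ such that fderiv ℝ F (x,v) (v', p') = ⟪a(x,v), v'⟫ for all (x,v) and all (v',p') (i.e., α = dF is exact). Then a(x,v) = 0 for all (x,v). -/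
open InnerProductSpace

/-- The contact system contains no exact 1-form other than 0: if the horizontal
1-form `α(x,v) = ⟪a(x,v), ·⟫` belongs to the contact system (`⟪a(x,v), v⟫ = 0`)
and is the differential of a function `F` on the tangent bundle, then `a = 0`. -/
theorem contact_exact_form_is_zero (n : ℕ) (hn : 1 ≤ n)
    (a : EuclideanSpace ℝ (Fin n) × EuclideanSpace ℝ (Fin n) → EuclideanSpace ℝ (Fin n))
    (hcontact : ∀ xv : EuclideanSpace ℝ (Fin n) × EuclideanSpace ℝ (Fin n),
      ⟪a xv, xv.2⟫_ℝ = 0)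
    (F : EuclideanSpace ℝ (Fin n) × EuclideanSpace ℝ (Fin n) → ℝ)
    (hF : Differentiable ℝ F)
    (hexact : ∀ (xv : EuclideanSpace ℝ (Fin n) × EuclideanSpace ℝ (Fin n))
      (v' p' : EuclideanSpace ℝ (Fin n)),
      fderiv ℝ F xv (v', p') = ⟪a xv, v'⟫_ℝ) :
    ∀ xv : EuclideanSpace ℝ (Fin n) × EuclideanSpace ℝ (Fin n), a xv = 0 := by
  intro xv
  -- `F` does not depend on the velocity
  have hconst : ∀ x v w : EuclideanSpace ℝ (Fin n), F (x, v) = F (x, w) := by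
    intro x v w
    have hd : ∀ u : EuclideanSpace ℝ (Fin n),
        HasFDerivAt (fun u => F (x, u))
          ((fderiv ℝ F (x, u)).comp (ContinuousLinearMap.inr ℝ _ _)) u := fun u =>
      (hF (x, u)).hasFDerivAt.comp u (hasFDerivAt_prodMk_right x u)
    refine is_const_of_fderiv_eq_zero (𝕜 := ℝ) (f := fun u => F (x, u))
      (fun u => (hd u).differentiableAt) (fun u => ?_) v w
    rw [(hd u).fderiv]
    ext p
    simp [hexact]
  -- hence `F` is invariant under vertical translations, and so is `a`
  have hinv : ∀ c : EuclideanSpace ℝ (Fin n), a (xv + (0, c)) = a xv := by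
    intro c
    have hFc : (fun p => F (p + (0, c))) = F := by
      funext p
      have h := hconst p.1 (p.2 + c) p.2
      have e : p + (0, c) = (p.1, p.2 + c) := by ext <;> simp
      rw [e, h]
    have hfd : fderiv ℝ F (xv + (0, c)) = fderiv ℝ F xv := by
      rw [← fderiv_comp_add_right, hFc]
    refine ext_inner_right ℝ fun v' => ?_
    rw [← hexact _ v' 0, ← hexact _ v' 0, hfd]
  have h := hcontact (xv + (0, a xv - xv.2))
  rw [hinv] at h
  have e : (xv + (0, a xv - xv.2)).2 = a xv := by simp
  rw [e] at h
  exact inner_self_eq_zero.mp h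
end

section
/- Fix n ≥ 1. Let a, v ∈ EuclideanSpace ℝ (Fin n) with ⟪a, v⟫ = 0 and v ≠ 0. Then there exists an antisymmetric continuous linear map G : EuclideanSpace ℝ (Fin n) →L[ℝ] EuclideanSpace ℝ (Fin n) (i.e., ⟪G u, w⟫ = −⟪G w, u⟫ for all u, w) such that G v = a; explicitly, G u = (⟪v, u⟫ • a − ⟪a, u⟫ • v) / ‖v‖² works. Consequently, every relativistic force value at a nonzero velocity is produced by a hemisymmetric covariant 2-tensor. -/
open InnerProductSpace

/-- Every relativistic force value at a nonzero velocity is produced by an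
antisymmetric 2-tensor: if `⟪a, v⟫ = 0` and `v ≠ 0`, there is an antisymmetric
continuous linear map `G` with `G v = a`, explicitly
`G u = (⟪v,u⟫ • a − ⟪a,u⟫ • v) / ‖v‖²`. -/
theorem exists_antisymmetric_producing_force (n : ℕ) (hn : 1 ≤ n)
    (a v : EuclideanSpace ℝ (Fin n)) (hav : ⟪a, v⟫_ℝ = 0) (hv : v ≠ 0) :
    ∃ G : EuclideanSpace ℝ (Fin n) →L[ℝ] EuclideanSpace ℝ (Fin n),
      (∀ u w, ⟪G u, w⟫_ℝ = -⟪G w, u⟫_ℝ) ∧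
      G v = a ∧
      (∀ u, G u = (‖v‖ ^ 2)⁻¹ • (⟪v, u⟫_ℝ • a - ⟪a, u⟫_ℝ • v)) := by
  have key : ∃ G : EuclideanSpace ℝ (Fin n) →L[ℝ] EuclideanSpace ℝ (Fin n),
      ∀ u, G u = (‖v‖ ^ 2)⁻¹ • (⟪v, u⟫_ℝ • a - ⟪a, u⟫_ℝ • v) :=
    ⟨(‖v‖ ^ 2)⁻¹ • ((innerSL ℝ v).smulRight a - (innerSL ℝ a).smulRight v),
      fun u => by simp⟩
  obtain ⟨G, hG⟩ := key
  refine ⟨G, ?_, ?_, hG⟩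
  · intro u w
    rw [hG, hG]
    simp only [real_inner_smul_left, inner_sub_left]
    ring
  · have h : ‖v‖ ^ 2 ≠ 0 := pow_ne_zero 2 (norm_ne_zero_iff.mpr hv)
    rw [hG, hav, real_inner_self_eq_norm_sq, zero_smul, sub_zero, smul_smul,
      inv_mul_cancel₀ h, one_smul]
end

section
/- Fix n ≥ 1, a real constant h ≠ 0, real E, a twice continuously differentiable f : EuclideanSpace ℝ (Fin n) → ℝ, and V : EuclideanSpace ℝ (Fin n) → ℝ. Let Ψ : EuclideanSpace ℝ (Fin n) → ℂ be Ψ(x) = Complex.exp(i·f(x)/h). Then the Schrödinger equation (h²/2)·ΔΨ(x) − V(x)·Ψ(x) = −E·Ψ(x) holds for all x if and only if Δf(x) = 0 and ½‖∇f(x)‖² + V(x) = E for all x, where Δ denotes the Euclidean Laplacian Δg(x) = ∑ᵢ ∂²g/∂xᵢ²(x) (the trace of the second derivative of g at x in an orthonormal basis) and ∇f is the gradient of f. -/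
open InnerProductSpace

/-- Euclidean Laplacian: the trace of the second derivative in the standard
orthonormal basis, `Δg(x) = ∑ᵢ ∂²g/∂xᵢ²(x)`. -/
noncomputable def euclideanLaplacian {n : ℕ} {F : Type*} [NormedAddCommGroup F]
    [NormedSpace ℝ F] (g : EuclideanSpace ℝ (Fin n) → F) (x : EuclideanSpace ℝ (Fin n)) : F :=
  ∑ i : Fin n, fderiv ℝ (fun y => fderiv ℝ g y (EuclideanSpace.single i 1)) x
    (EuclideanSpace.single i 1)

theorem aux_fderiv_ofReal {n : ℕ} (g : EuclideanSpace ℝ (Fin n) → ℝ)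
    (x : EuclideanSpace ℝ (Fin n)) (hg : DifferentiableAt ℝ g x) :
    HasFDerivAt (fun y => (g y : ℂ)) (Complex.ofRealCLM.comp (fderiv ℝ g x)) x :=
  Complex.ofRealCLM.hasFDerivAt.comp x hg.hasFDerivAt

theorem aux_fderiv_exp {n : ℕ} (c : ℂ) (f : EuclideanSpace ℝ (Fin n) → ℝ)
    (x : EuclideanSpace ℝ (Fin n)) (hf : DifferentiableAt ℝ f x) :
    HasFDerivAt (fun y => Complex.exp (c * (f y : ℂ)))
      (Complex.exp (c * (f x : ℂ)) • (c • Complex.ofRealCLM.comp (fderiv ℝ f x))) x :=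
  ((aux_fderiv_ofReal f x hf).const_mul c).cexp

theorem aux_laplacian_exp {n : ℕ} (c : ℂ) (f : EuclideanSpace ℝ (Fin n) → ℝ)
    (hf : ContDiff ℝ 2 f) (x : EuclideanSpace ℝ (Fin n)) :
    euclideanLaplacian (fun y => Complex.exp (c * (f y : ℂ))) x =
      Complex.exp (c * (f x : ℂ)) * (c * ((euclideanLaplacian f x : ℝ) : ℂ)
        + c ^ 2 * ((‖gradient f x‖ ^ 2 : ℝ) : ℂ)) := by
  have hd : Differentiable ℝ f := hf.differentiable (by norm_num)
  have hd2 : Differentiable ℝ (fderiv ℝ f) :=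
    (hf.fderiv_right (m := 1) (by norm_num)).differentiable (by norm_num)
  have hgrad : ‖gradient f x‖ ^ 2 =
      ∑ i : Fin n, (fderiv ℝ f x (EuclideanSpace.single i 1)) ^ 2 := by
    rw [EuclideanSpace.real_norm_sq_eq]
    refine Finset.sum_congr rfl fun i _ => ?_
    congr 1
    have h1 : inner ℝ (gradient f x) (EuclideanSpace.single i (1 : ℝ)) =
        fderiv ℝ f x (EuclideanSpace.single i 1) := by
      simp only [gradient, InnerProductSpace.toDual_symm_apply]
    rw [← h1, EuclideanSpace.inner_single_right]
    simp
  rw [hgrad]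
  unfold euclideanLaplacian
  push_cast
  rw [Finset.mul_sum, Finset.mul_sum, ← Finset.sum_add_distrib, Finset.mul_sum]
  refine Finset.sum_congr rfl fun i _ => ?_
  have e1 : (fun y => fderiv ℝ (fun y => Complex.exp (c * (f y : ℂ))) y
      (EuclideanSpace.single i 1)) = fun y => Complex.exp (c * (f y : ℂ)) *
        (c * ((fderiv ℝ f y (EuclideanSpace.single i 1) : ℝ) : ℂ)) := by
    funext y
    rw [(aux_fderiv_exp c f y (hd y)).fderiv]
    simp
  have hg : DifferentiableAt ℝ (fun y => fderiv ℝ f y (EuclideanSpace.single i (1 : ℝ))) x :=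
    (hd2 x).clm_apply (differentiableAt_const _)
  have e2 := ((aux_fderiv_exp c f x (hd x)).mul
    ((aux_fderiv_ofReal _ x hg).const_mul c)).fderiv
  rw [e1]
  erw [e2]
  simp
  ring

/-- The stationary Schrödinger equation `((h²/2)Δ − V)Ψ = −EΨ` for
`Ψ = e^{if/h}` holds iff `f` is harmonic (`Δf = 0`) and satisfies the
Hamilton–Jacobi equation `½‖∇f‖² + V = E`. -/
theorem schroedinger_iff_harmonic_hamilton_jacobi (n : ℕ) (hn : 1 ≤ n)
    (h : ℝ) (hh : h ≠ 0) (E : ℝ)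
    (f : EuclideanSpace ℝ (Fin n) → ℝ) (hf : ContDiff ℝ 2 f)
    (V : EuclideanSpace ℝ (Fin n) → ℝ)
    (Ψ : EuclideanSpace ℝ (Fin n) → ℂ)
    (hΨ : ∀ x, Ψ x = Complex.exp (Complex.I * (f x : ℂ) / (h : ℂ))) :
    (∀ x, ((h ^ 2 / 2 : ℝ) : ℂ) * euclideanLaplacian Ψ x - (V x : ℂ) * Ψ x
        = -(E : ℂ) * Ψ x) ↔
    (∀ x, euclideanLaplacian f x = 0 ∧ (1 / 2) * ‖gradient f x‖ ^ 2 + V x = E) := by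
  have hΨ' : Ψ = fun y => Complex.exp ((Complex.I / (h : ℂ)) * (f y : ℂ)) := by
    funext y
    rw [hΨ y]
    congr 1
    ring
  have hc : (h : ℂ) ≠ 0 := by exact_mod_cast hh
  refine forall_congr' fun x => ?_
  subst hΨ'
  rw [aux_laplacian_exp _ f hf x]
  have he := Complex.exp_ne_zero ((Complex.I / (h : ℂ)) * (f x : ℂ))
  set e := Complex.exp ((Complex.I / (h : ℂ)) * (f x : ℂ))
  set L := euclideanLaplacian f x
  set G := ‖gradient f x‖ ^ 2
  have key : ((h ^ 2 / 2 : ℝ) : ℂ) * (e * (Complex.I / (h : ℂ) * (L : ℂ)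
        + (Complex.I / (h : ℂ)) ^ 2 * (G : ℂ))) - (V x : ℂ) * e - (-(E : ℂ) * e)
      = e * (((E - 1 / 2 * G - V x : ℝ) : ℂ) + ((h / 2 * L : ℝ) : ℂ) * Complex.I) := by
    push_cast
    field_simp
    linear_combination (G : ℂ) * Complex.I_sq
  rw [← sub_eq_zero, key, mul_eq_zero, or_iff_right he, Complex.ext_iff]
  simp only [Complex.add_re, Complex.add_im, Complex.re_ofReal_mul, Complex.im_ofReal_mul,
    Complex.ofReal_re, Complex.ofReal_im, Complex.I_re, Complex.I_im, Complex.zero_re,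
    Complex.zero_im, mul_zero, mul_one, add_zero, zero_add]
  constructor
  · rintro ⟨h1, h2⟩
    refine ⟨?_, by linarith⟩
    rcases mul_eq_zero.1 h2 with h3 | h3
    · exact absurd h3 (div_ne_zero hh two_ne_zero)
    · exact h3
  · rintro ⟨h1, h2⟩
    exact ⟨by linarith, by rw [h1, mul_zero]⟩
end

section
/- Fix n ≥ 1. Let A : EuclideanSpace ℝ (Fin n) → EuclideanSpace ℝ (Fin n) be continuously differentiable, f : EuclideanSpace ℝ (Fin n) → ℝ twice continuously differentiable, and set u = ∇f − A. Define for each x the antisymmetric linear map F(x) = (fderiv ℝ A x)† − fderiv ℝ A x, where † denotes the adjoint with respect to the Euclidean inner product (in coordinates, F(x)ᵢⱼ = ∂Aⱼ/∂xᵢ − ∂Aᵢ/∂xⱼ). Then for all x: (fderiv ℝ u x)(u x) = F(x)(u x) + ∇(½‖u‖²)(x). Consequently, u satisfies the Lorentz intermediate-integral equation (fderiv ℝ u x)(u x) = F(x)(u x) for all x if and only if the function x ↦ ½‖u(x)‖² has zero derivative at every point, i.e., is constant. -/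
open InnerProductSpace

/-- Lorentz intermediate integrals and the Hamilton–Jacobi equation, flat case:
for a vector potential `A` and `u = ∇f − A`, with the electromagnetic field
`F(x) = (fderiv A x)† − fderiv A x`, one has the identity
`(fderiv u)(u) = F(u) + ∇(½‖u‖²)`; consequently `u` satisfies the Lorentz
intermediate-integral equation `(fderiv u)(u) = F(u)` iff `½‖u‖²` has zero
derivative everywhere, i.e. is constant. -/
theorem lorentz_intermediate_integral (n : ℕ) (hn : 1 ≤ n)
    (A : EuclideanSpace ℝ (Fin n) → EuclideanSpace ℝ (Fin n)) (hA : ContDiff ℝ 1 A)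
    (f : EuclideanSpace ℝ (Fin n) → ℝ) (hf : ContDiff ℝ 2 f)
    (u : EuclideanSpace ℝ (Fin n) → EuclideanSpace ℝ (Fin n))
    (hu : ∀ x, u x = gradient f x - A x)
    (F : EuclideanSpace ℝ (Fin n) →
      (EuclideanSpace ℝ (Fin n) →L[ℝ] EuclideanSpace ℝ (Fin n)))
    (hF : ∀ x, F x = ContinuousLinearMap.adjoint (fderiv ℝ A x) - fderiv ℝ A x) :
    (∀ x, fderiv ℝ u x (u x)
        = F x (u x) + gradient (fun y => (1 / 2) * ‖u y‖ ^ 2) x) ∧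
    ((∀ x, fderiv ℝ u x (u x) = F x (u x)) ↔
      (∀ x, fderiv ℝ (fun y => (1 / 2) * ‖u y‖ ^ 2) x = 0)) ∧
    ((∀ x, fderiv ℝ (fun y => (1 / 2) * ‖u y‖ ^ 2) x = 0) ↔
      (∀ x y, (1 / 2) * ‖u x‖ ^ 2 = (1 / 2) * ‖u y‖ ^ 2)) := by
  have hfd : Differentiable ℝ (fderiv ℝ f) :=
    (hf.fderiv_right (m := 1) (by norm_num)).differentiable (by norm_num)
  have hAd : Differentiable ℝ A := hA.differentiable (by norm_num)
  have hG : Differentiable ℝ (gradient f) := by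
    intro x
    exact ((toDual ℝ (EuclideanSpace ℝ (Fin n))).symm.toContinuousLinearEquiv
      |>.differentiableAt).comp x (hfd x)
  have hGi : ∀ x v w, inner ℝ (fderiv ℝ (gradient f) x v) w
      = fderiv ℝ (fderiv ℝ f) x v w := by
    intro x v w
    have h1 : HasFDerivAt (fun y => inner ℝ (gradient f y) w) _ x :=
      (hG x).hasFDerivAt.inner ℝ (hasFDerivAt_const w x)
    have h2 : HasFDerivAt (fun y => fderiv ℝ f y w) _ x :=
      (hfd x).hasFDerivAt.clm_apply (hasFDerivAt_const w x)
    have h3 : (fun y => inner ℝ (gradient f y) w) = (fun y => fderiv ℝ f y w) := by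
      funext y
      exact inner_gradient_left
    rw [h3] at h1
    have h4 := congrArg (fun L => L v) (h1.unique h2)
    simpa using h4
  have hsymm : ∀ x v w, inner ℝ (fderiv ℝ (gradient f) x v) w
      = inner ℝ (fderiv ℝ (gradient f) x w) v := by
    intro x v w
    rw [hGi, hGi]
    exact (hf.contDiffAt.isSymmSndFDerivAt (by simp)).eq v w
  have hu' : u = fun x => gradient f x - A x := funext hu
  have hud : Differentiable ℝ u := by
    rw [hu']
    exact hG.sub hAd
  have hDu : ∀ x v, fderiv ℝ u x v = fderiv ℝ (gradient f) x v - fderiv ℝ A x v := by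
    intro x v
    rw [hu', fderiv_fun_sub (hG x) (hAd x)]
    rfl
  have hTd : Differentiable ℝ (fun y => (1 / 2 : ℝ) * ‖u y‖ ^ 2) :=
    (hud.norm_sq ℝ).const_mul _
  have hT : ∀ x v, fderiv ℝ (fun y => (1 / 2 : ℝ) * ‖u y‖ ^ 2) x v
      = inner ℝ (u x) (fderiv ℝ u x v) := by
    intro x v
    have h := ((hud x).hasFDerivAt.norm_sq).const_mul (1 / 2 : ℝ)
    rw [h.fderiv]
    simp
  have key : ∀ x, fderiv ℝ u x (u x)
        = F x (u x) + gradient (fun y => (1 / 2) * ‖u y‖ ^ 2) x := by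
    intro x
    refine ext_inner_right ℝ fun v => ?_
    rw [inner_add_left, inner_gradient_left, hT, hDu, hDu, hF,
      _root_.sub_apply, inner_sub_left, inner_sub_left, inner_sub_right,
      ContinuousLinearMap.adjoint_inner_left, hsymm, real_inner_comm]
    ring
  refine ⟨key, ?_, ?_⟩
  · refine forall_congr' fun x => ?_
    rw [key x, add_eq_left, ← toDual_gradient]
    exact (map_eq_zero_iff _ (toDual ℝ (EuclideanSpace ℝ (Fin n))).injective).symm
  · constructor
    · intro h x y
      exact is_const_of_fderiv_eq_zero hTd h x y
    · intro h x
      have h' : (fun y => (1 / 2 : ℝ) * ‖u y‖ ^ 2) = fun _ => (1 / 2 : ℝ) * ‖u x‖ ^ 2 :=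
        funext fun y => h y x
      rw [h']
      simp
end

section
/- Fix n ≥ 1, a real constant h ≠ 0, and a real constant m. Let A : EuclideanSpace ℝ (Fin n) → EuclideanSpace ℝ (Fin n) be continuously differentiable and f : EuclideanSpace ℝ (Fin n) → ℝ twice continuously differentiable, and let Ψ(x) = Complex.exp(i·f(x)/h). Then the Klein–Gordon equation ΔΨ(x) − (2i/h)·(fderiv ℝ Ψ x)(A x) + (1/h²)·(m² − ‖A(x)‖²)·Ψ(x) = 0 holds for all x if and only if Δf(x) = 0 and ‖∇f(x) − A(x)‖² = m² for all x, where Δ denotes the Euclidean Laplacian Δg(x) = ∑ᵢ ∂²g/∂xᵢ²(x) (the trace of the second derivative of g at x in an orthonormal basis), ∇f is the gradient of f, and (fderiv ℝ Ψ x)(A x) is the directional derivative of Ψ along A. -/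
open InnerProductSpace

lemma kg_fderiv_exp {E : Type*} [NormedAddCommGroup E] [NormedSpace ℝ E]
    (h : ℝ) (f : E → ℝ) (Ψ : E → ℂ)
    (hΨ : ∀ x, Ψ x = Complex.exp (Complex.I * (f x : ℂ) / (h : ℂ)))
    (x : E) (hf : DifferentiableAt ℝ f x) :
    HasFDerivAt Ψ ((Complex.I / (h : ℂ) * Ψ x) • (Complex.ofRealCLM.comp (fderiv ℝ f x))) x := by
  have h1 : HasFDerivAt (fun y => (f y : ℂ)) (Complex.ofRealCLM.comp (fderiv ℝ f x)) x :=
    Complex.ofRealCLM.hasFDerivAt.comp x hf.hasFDerivAt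
  have h2 := (h1.const_mul (Complex.I / (h : ℂ))).cexp
  have h3 : Ψ = fun y => Complex.exp (Complex.I / (h : ℂ) * (f y : ℂ)) := by
    funext y
    rw [hΨ y]
    congr 1
    ring
  rw [h3]
  refine h2.congr_fderiv ?_
  rw [smul_smul, mul_comm]

/-- The Klein–Gordon equation
`ΔΨ − (2i/h)·(dΨ)(A) + (1/h²)(m² − ‖A‖²)Ψ = 0` for `Ψ = e^{if/h}` holds iff
`Δf = 0` and `‖∇f − A‖² = m²`. -/
theorem klein_gordon_iff (n : ℕ) (hn : 1 ≤ n)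
    (h : ℝ) (hh : h ≠ 0) (m : ℝ)
    (A : EuclideanSpace ℝ (Fin n) → EuclideanSpace ℝ (Fin n)) (hA : ContDiff ℝ 1 A)
    (f : EuclideanSpace ℝ (Fin n) → ℝ) (hf : ContDiff ℝ 2 f)
    (Ψ : EuclideanSpace ℝ (Fin n) → ℂ)
    (hΨ : ∀ x, Ψ x = Complex.exp (Complex.I * (f x : ℂ) / (h : ℂ))) :
    (∀ x, euclideanLaplacian Ψ x
        - (2 * Complex.I / (h : ℂ)) * fderiv ℝ Ψ x (A x)
        + (1 / (h : ℂ) ^ 2) * ((m ^ 2 - ‖A x‖ ^ 2 : ℝ) : ℂ) * Ψ x = 0) ↔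
    (∀ x, euclideanLaplacian f x = 0 ∧ ‖gradient f x - A x‖ ^ 2 = m ^ 2) := by
  have hdf : Differentiable ℝ f := hf.differentiable (by norm_num)
  have hd2 : Differentiable ℝ (fderiv ℝ f) :=
    (hf.fderiv_right (m := 1) (by norm_num)).differentiable (by norm_num)
  have hfd : ∀ x v, fderiv ℝ Ψ x v = Complex.I / (h : ℂ) * Ψ x * ((fderiv ℝ f x v : ℝ) : ℂ) := by
    intro x v
    rw [(kg_fderiv_exp h f Ψ hΨ x (hdf x)).fderiv]
    simp
  have hsec : ∀ x v, fderiv ℝ (fun y => fderiv ℝ Ψ y v) x v =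
      (Complex.I / (h : ℂ) * ((fderiv ℝ (fun y => fderiv ℝ f y v) x v : ℝ) : ℂ)
        - 1 / (h : ℂ) ^ 2 * (((fderiv ℝ f x v) ^ 2 : ℝ) : ℂ)) * Ψ x := by
    intro x v
    have e : (fun y => fderiv ℝ Ψ y v) =
        fun y => Complex.I / (h : ℂ) * Ψ y * ((fderiv ℝ f y v : ℝ) : ℂ) := by
      funext y
      exact hfd y v
    have hg : DifferentiableAt ℝ (fun y => fderiv ℝ f y v) x :=
      (hd2 x).clm_apply (differentiableAt_const v)
    have h1 : HasFDerivAt (fun y => ((fderiv ℝ f y v : ℝ) : ℂ))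
        (Complex.ofRealCLM.comp (fderiv ℝ (fun y => fderiv ℝ f y v) x)) x :=
      Complex.ofRealCLM.hasFDerivAt.comp x hg.hasFDerivAt
    have h2 := ((kg_fderiv_exp h f Ψ hΨ x (hdf x)).const_mul (Complex.I / (h : ℂ))).mul h1
    rw [e]
    erw [h2.fderiv]
    simp only [add_apply, smul_apply,
      ContinuousLinearMap.comp_apply, Complex.ofRealCLM_apply, smul_eq_mul]
    push_cast
    linear_combination (Ψ x * (fderiv ℝ f x v : ℂ) ^ 2 / (h : ℂ) ^ 2) * Complex.I_sq
  have hnorm : ∀ x, ∑ i : Fin n, (fderiv ℝ f x (EuclideanSpace.single i 1)) ^ 2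
      = ‖gradient f x‖ ^ 2 := by
    intro x
    rw [EuclideanSpace.real_norm_sq_eq]
    refine Finset.sum_congr rfl fun i _ => ?_
    rw [← inner_gradient_left]
    rw [EuclideanSpace.inner_single_right]
    simp
  have hlap : ∀ x, euclideanLaplacian Ψ x =
      (Complex.I / (h : ℂ) * ((euclideanLaplacian f x : ℝ) : ℂ)
        - 1 / (h : ℂ) ^ 2 * ((‖gradient f x‖ ^ 2 : ℝ) : ℂ)) * Ψ x := by
    intro x
    rw [← hnorm x]
    unfold euclideanLaplacian
    rw [Finset.sum_congr rfl fun i _ => hsec x _]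
    rw [← Finset.sum_mul, Finset.sum_sub_distrib, ← Finset.mul_sum, ← Finset.mul_sum]
    push_cast
    rfl
  refine forall_congr' fun x => ?_
  have hΨ0 : Ψ x ≠ 0 := by
    rw [hΨ]
    exact Complex.exp_ne_zero _
  have hhc : (h : ℂ) ≠ 0 := by exact_mod_cast hh
  have hinner : fderiv ℝ f x (A x) = inner ℝ (gradient f x) (A x) :=
    (inner_gradient_left).symm
  have key : euclideanLaplacian Ψ x
        - (2 * Complex.I / (h : ℂ)) * fderiv ℝ Ψ x (A x)
        + (1 / (h : ℂ) ^ 2) * ((m ^ 2 - ‖A x‖ ^ 2 : ℝ) : ℂ) * Ψ x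
      = (Ψ x / (h : ℂ) ^ 2) * (((m ^ 2 - ‖gradient f x - A x‖ ^ 2 : ℝ) : ℂ)
          + ((h * euclideanLaplacian f x : ℝ) : ℂ) * Complex.I) := by
    rw [hlap, hfd, hinner, norm_sub_sq_real]
    push_cast
    field_simp
    linear_combination (-2 * ((inner ℝ (gradient f x) (A x) : ℝ) : ℂ)) * Complex.I_sq
  rw [key, mul_eq_zero, or_iff_right (div_ne_zero hΨ0 (pow_ne_zero 2 hhc))]
  constructor
  · intro H
    rw [← Complex.mk_eq_add_mul_I, Complex.ext_iff] at H
    obtain ⟨hr, hi⟩ := H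
    simp only [Complex.zero_re, Complex.zero_im] at hr hi
    exact ⟨(mul_eq_zero.mp hi).resolve_left hh, by linarith⟩
  · rintro ⟨h1, h2⟩
    rw [h1, h2]
    simp
end
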